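/- arXiv:1104.2194 — 2 statements merged into one kernel-verified Lean document; each statement's English description precedes it below -/
import Mathlib

section
/- The function (x, y, t) ↦ y² / ((x² + y²)·((x − t)² + y²)·((x − 1)² + y²)) is Lebesgue integrable on ℝ² × (0, 1), and ∫₀¹ ∫_{ℝ²} y² / ((x² + y²)·((x − t)² + y²)·((x − 1)² + y²)) dx dy dt = π³/3. Equivalently, 1/(2π)³ times this integral equals 1/24. -/
open MeasureTheory

/-- The weight integrand for the component `𝒱_{1,3}`: in coordinates
`((x, y), t)` with free point `z = x + iy` and middle collinear point `t`, it is
`y² / ((x² + y²)·((x − t)² + y²)·((x − 1)² + y²))`. -/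
noncomputable def weightIntegrand (p : (ℝ × ℝ) × ℝ) : ℝ :=
  p.1.2 ^ 2 /
    ((p.1.1 ^ 2 + p.1.2 ^ 2) * ((p.1.1 - p.2) ^ 2 + p.1.2 ^ 2) *
      ((p.1.1 - 1) ^ 2 + p.1.2 ^ 2))

/-- The weight integrand after integration over `t`. -/
noncomputable def wG (x y : ℝ) : ℝ :=
  y * (Real.arctan (x / y) - Real.arctan ((x - 1) / y)) /
    ((x ^ 2 + y ^ 2) * ((x - 1) ^ 2 + y ^ 2))

/-- The integrand after rescaling `x = y a`. -/
noncomputable def wK (a y : ℝ) : ℝ :=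
  (Real.arctan a - Real.arctan (a - 1 / y)) /
    (y ^ 2 * (1 + a ^ 2) * (1 + (a - 1 / y) ^ 2))

lemma wG_measurable : Measurable (fun q : ℝ × ℝ => wG q.1 q.2) := by
  unfold wG; fun_prop

lemma wK_measurable : Measurable (fun q : ℝ × ℝ => wK q.1 q.2) := by
  unfold wK; fun_prop

lemma w_measurable : Measurable weightIntegrand := by
  unfold weightIntegrand; fun_prop

lemma w_nonneg (p) : 0 ≤ weightIntegrand p := by
  unfold weightIntegrand; positivity

lemma step_t (x y : ℝ) (hy : y ≠ 0) :
    ∫⁻ t in Set.Ioo (0:ℝ) 1, ENNReal.ofReal (weightIntegrand ((x, y), t))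
      = ENNReal.ofReal (wG x y) := by
  have hy2 : 0 < y ^ 2 := by positivity
  have hd : ∀ t : ℝ, HasDerivAt
      (fun t => -(y * Real.arctan ((x - t) / y)) / ((x ^ 2 + y ^ 2) * ((x - 1) ^ 2 + y ^ 2)))
      (weightIntegrand ((x, y), t)) t := by
    intro t
    have h1 : HasDerivAt (fun t : ℝ => (x - t) / y) (-1 / y) t :=
      ((hasDerivAt_id t).const_sub x).div_const y
    have h2 := ((h1.arctan.const_mul y).neg).div_const ((x ^ 2 + y ^ 2) * ((x - 1) ^ 2 + y ^ 2))
    refine h2.congr_deriv ?_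
    unfold weightIntegrand
    simp only
    have e1 : 0 < x ^ 2 + y ^ 2 := by positivity
    have e2 : 0 < (x - t) ^ 2 + y ^ 2 := by positivity
    have e3 : 0 < (x - 1) ^ 2 + y ^ 2 := by positivity
    have e4 : 1 + ((x - t) / y) ^ 2 = ((x - t) ^ 2 + y ^ 2) / y ^ 2 := by
      field_simp; ring
    rw [e4]
    field_simp
  have hc : Continuous (fun t => weightIntegrand ((x, y), t)) := by
    unfold weightIntegrand
    simp only
    refine continuous_const.div (by fun_prop) ?_
    intro t
    positivity
  have hi : IntegrableOn (fun t => weightIntegrand ((x, y), t)) (Set.Ioo (0:ℝ) 1) :=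
    (hc.integrableOn_Icc (a := 0) (b := 1)).mono_set Set.Ioo_subset_Icc_self
  rw [← ofReal_integral_eq_lintegral_ofReal hi (Filter.Eventually.of_forall fun t => w_nonneg _),
    ← integral_Ioc_eq_integral_Ioo, ← intervalIntegral.integral_of_le zero_le_one,
    intervalIntegral.integral_eq_sub_of_hasDerivAt (fun t _ => hd t) (hc.intervalIntegrable _ _)]
  congr 1
  unfold wG
  rw [sub_zero]
  ring

lemma step_scale (y : ℝ) (hy : 0 < y) :
    ∫⁻ x, ENNReal.ofReal (wG x y) = ∫⁻ a, ENNReal.ofReal (wK a y) := by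
  have hm : Measurable (fun x => ENNReal.ofReal (wG x y)) := by
    unfold wG; fun_prop
  conv_lhs => rw [← Real.smul_map_volume_mul_left hy.ne']
  rw [lintegral_smul_measure, lintegral_map hm (by fun_prop), smul_eq_mul,
    ← lintegral_const_mul _ (by exact hm.comp (measurable_const_mul y))]
  refine lintegral_congr fun a => ?_
  rw [← ENNReal.ofReal_mul (abs_nonneg y), abs_of_pos hy]
  congr 1
  unfold wG wK
  have h1 : y * a / y = a := by field_simp
  have h2 : (y * a - 1) / y = a - 1 / y := by field_simp
  have h3 : (y * a - 1) ^ 2 + y ^ 2 = y ^ 2 * (1 + (a - 1 / y) ^ 2) := by field_simp; ring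
  have h4 : (y * a) ^ 2 + y ^ 2 = y ^ 2 * (1 + a ^ 2) := by ring
  rw [h1, h2, h3, h4]
  have e1 : 0 < 1 + a ^ 2 := by positivity
  have e2 : 0 < 1 + (a - 1 / y) ^ 2 := by positivity
  generalize 1 + (a - 1 / y) ^ 2 = B at *
  generalize 1 + a ^ 2 = A at *
  generalize Real.arctan (a - 1 / y) = C
  field_simp

lemma wK_nonneg (a y : ℝ) (hy : 0 < y) : 0 ≤ wK a y := by
  unfold wK
  apply div_nonneg _ (by positivity)
  have : Real.arctan (a - 1 / y) ≤ Real.arctan a := by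
    apply Real.arctan_strictMono.monotone
    have : 0 < 1 / y := by positivity
    linarith
  linarith

open Filter Topology in
lemma step_y (a : ℝ) :
    ∫⁻ y in Set.Ioi (0:ℝ), ENNReal.ofReal (wK a y)
      = ENNReal.ofReal ((Real.arctan a + Real.pi / 2) ^ 2 / 2 / (1 + a ^ 2)) := by
  let g : ℝ → ℝ := fun y => if y ≤ 0 then -((Real.arctan a + Real.pi / 2) ^ 2 / 2 / (1 + a ^ 2))
    else -((Real.arctan a - Real.arctan (a - 1 / y)) ^ 2 / 2 / (1 + a ^ 2))
  have hA : 0 < 1 + a ^ 2 := by positivity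
  have hg0 : g 0 = -((Real.arctan a + Real.pi / 2) ^ 2 / 2 / (1 + a ^ 2)) := by simp [g]
  have hcont : ContinuousWithinAt g (Set.Ici 0) 0 := by
    rw [← continuousWithinAt_Ioi_iff_Ici]
    unfold ContinuousWithinAt
    rw [hg0]
    have ht : Tendsto (fun y : ℝ => a - 1 / y) (𝓝[>] 0) atBot := by
      simp only [one_div, sub_eq_add_neg]
      exact tendsto_atBot_add_const_left _ _ (tendsto_neg_atTop_atBot.comp tendsto_inv_nhdsGT_zero)
    have h2 : Tendsto (fun y : ℝ => Real.arctan (a - 1 / y)) (𝓝[>] 0) (𝓝 (-(Real.pi / 2))) :=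
      (tendsto_nhds_of_tendsto_nhdsWithin Real.tendsto_arctan_atBot).comp ht
    have h3 := ((((h2.const_sub (Real.arctan a)).pow 2).div_const 2).div_const (1 + a ^ 2)).neg
    rw [sub_neg_eq_add] at h3
    refine h3.congr' ?_
    filter_upwards [self_mem_nhdsWithin] with y hy
    simp [g, not_le.2 (Set.mem_Ioi.1 hy)]
  have hd : ∀ y ∈ Set.Ioi (0:ℝ), HasDerivAt g (wK a y) y := by
    intro y hy
    have hy0 : 0 < y := hy
    have h1 : HasDerivAt (fun y : ℝ => a - 1 / y) (1 / y ^ 2) y := by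
      have := (hasDerivAt_inv hy0.ne').const_sub a
      simp only [one_div]
      exact this.congr_deriv (by simp)
    have h2 := ((((h1.arctan.const_sub (Real.arctan a)).pow 2).div_const 2).div_const
      (1 + a ^ 2)).neg
    have h3 := h2.congr_of_eventuallyEq (f₁ := g) (by
      filter_upwards [Ioi_mem_nhds hy0] with z hz
      simp [g, not_le.2 (Set.mem_Ioi.1 hz)])
    refine h3.congr_deriv ?_
    unfold wK
    have e2 : 0 < 1 + (a - 1 / y) ^ 2 := by positivity
    generalize 1 + (a - 1 / y) ^ 2 = B at *
    generalize Real.arctan (a - 1 / y) = C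
    field_simp
    try ring
  have hlim : Tendsto g atTop (𝓝 0) := by
    have ht : Tendsto (fun y : ℝ => a - 1 / y) atTop (𝓝 a) := by
      simpa using (tendsto_inv_atTop_zero (𝕜 := ℝ)).const_sub a
    have h2 := (Real.continuous_arctan.tendsto a).comp ht
    have h3 := ((((h2.const_sub (Real.arctan a)).pow 2).div_const 2).div_const (1 + a ^ 2)).neg
    have h4 : -((Real.arctan a - Real.arctan a) ^ 2 / 2 / (1 + a ^ 2)) = 0 := by simp
    rw [h4] at h3
    refine h3.congr' ?_
    filter_upwards [Ioi_mem_atTop 0] with y hy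
    simp [g, not_le.2 (Set.mem_Ioi.1 hy)]
  have hp : ∀ y ∈ Set.Ioi (0:ℝ), 0 ≤ wK a y := fun y hy => wK_nonneg a y hy
  rw [← ofReal_integral_eq_lintegral_ofReal (integrableOn_Ioi_deriv_of_nonneg hcont hd hp hlim)
    ((ae_restrict_iff' measurableSet_Ioi).2 (Eventually.of_forall hp)),
    integral_Ioi_of_hasDerivAt_of_nonneg hcont hd hp hlim, hg0]
  congr 1
  ring

open Filter Topology in
lemma step_a :
    ∫⁻ a : ℝ, ENNReal.ofReal ((Real.arctan a + Real.pi / 2) ^ 2 / 2 / (1 + a ^ 2))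
      = ENNReal.ofReal (Real.pi ^ 3 / 6) := by
  have hd : ∀ a : ℝ, HasDerivAt (fun a => (Real.arctan a + Real.pi / 2) ^ 3 / 6)
      ((Real.arctan a + Real.pi / 2) ^ 2 / 2 / (1 + a ^ 2)) a := by
    intro a
    have h := ((((Real.hasDerivAt_arctan a).add_const (Real.pi / 2)).pow 3).div_const 6)
    refine h.congr_deriv ?_
    have hA : 0 < 1 + a ^ 2 := by positivity
    field_simp
    norm_num
    ring
  have hi : Integrable (fun a : ℝ => (Real.arctan a + Real.pi / 2) ^ 2 / 2 / (1 + a ^ 2)) := by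
    have := (integrable_inv_one_add_sq).bdd_mul (c := Real.pi ^ 2 / 2)
      (f := fun a : ℝ => (Real.arctan a + Real.pi / 2) ^ 2 / 2)
      (by
        apply Continuous.aestronglyMeasurable
        have := Real.continuous_arctan
        fun_prop)
      (Eventually.of_forall fun a => by
        have h1 := Real.neg_pi_div_two_lt_arctan a
        have h2 := Real.arctan_lt_pi_div_two a
        rw [Real.norm_of_nonneg (by positivity)]
        have : (Real.arctan a + Real.pi / 2) ^ 2 ≤ Real.pi ^ 2 := by
          apply pow_le_pow_left₀ <;> linarith
        linarith)
    simpa [div_eq_mul_inv] using this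
  rw [← ofReal_integral_eq_lintegral_ofReal hi
    (Eventually.of_forall fun a => by simp only [Pi.zero_apply]; positivity)]
  have hb := (((tendsto_nhds_of_tendsto_nhdsWithin Real.tendsto_arctan_atBot).add_const
    (Real.pi / 2)).pow 3).div_const 6
  have ht := (((tendsto_nhds_of_tendsto_nhdsWithin Real.tendsto_arctan_atTop).add_const
    (Real.pi / 2)).pow 3).div_const 6
  rw [integral_of_hasDerivAt_of_tendsto hd hi hb ht]
  congr 1
  ring

lemma half_double (f : ℝ → ENNReal) (hf : ∀ y, f (-y) = f y) :
    ∫⁻ y, f y = 2 * ∫⁻ y in Set.Ioi (0:ℝ), f y := by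
  rw [← lintegral_add_compl f (measurableSet_Ioi (a := (0:ℝ))), two_mul]
  congr 1
  rw [Set.compl_Ioi, setLIntegral_congr Iio_ae_eq_Iic.symm]
  have := (Measure.measurePreserving_neg (volume : Measure ℝ)).setLIntegral_comp_preimage_emb
    (MeasurableEquiv.neg ℝ).measurableEmbedding f (Set.Ioi 0)
  rw [← this]
  simp [hf]

lemma total : ∫⁻ p in (Set.univ : Set (ℝ × ℝ)) ×ˢ Set.Ioo (0 : ℝ) 1,
    ENNReal.ofReal (weightIntegrand p) = ENNReal.ofReal (Real.pi ^ 3 / 3) := by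
  rw [Measure.volume_eq_prod, ← Measure.prod_restrict, Measure.restrict_univ,
    lintegral_prod _ w_measurable.ennreal_ofReal.aemeasurable]
  have hae : ∀ᵐ q : ℝ × ℝ, q.2 ≠ 0 := by
    have : ∀ᵐ y : ℝ, y ≠ 0 := by simp [ae_iff]
    exact (Measure.quasiMeasurePreserving_snd (μ := (volume : Measure ℝ))
      (ν := (volume : Measure ℝ))).ae this
  have h1 : ∫⁻ q : ℝ × ℝ, ∫⁻ t in Set.Ioo (0:ℝ) 1, ENNReal.ofReal (weightIntegrand (q, t))
      = ∫⁻ q : ℝ × ℝ, ENNReal.ofReal (wG q.1 q.2) := by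
    refine lintegral_congr_ae ?_
    filter_upwards [hae] with q hq
    exact step_t q.1 q.2 hq
  rw [h1, Measure.volume_eq_prod, lintegral_prod_symm _ wG_measurable.ennreal_ofReal.aemeasurable]
  rw [half_double]
  swap
  · intro y
    refine lintegral_congr fun x => ?_
    simp only
    congr 1
    unfold wG
    simp only [div_neg, Real.arctan_neg, neg_sq]
    ring
  rw [setLIntegral_congr_fun measurableSet_Ioi (fun y hy => step_scale y hy)]
  rw [lintegral_lintegral_swap]
  swap
  · exact (wK_measurable.comp measurable_swap).ennreal_ofReal.aemeasurable
  simp_rw [step_y]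
  rw [step_a, show (2 : ENNReal) = ENNReal.ofReal 2 by simp, ← ENNReal.ofReal_mul (by norm_num)]
  congr 1
  ring

/-- the function `(x, y, t) ↦ y²/((x²+y²)((x−t)²+y²)((x−1)²+y²))` is
Lebesgue integrable on `ℝ² × (0,1)`, its integral equals `π³/3`, and hence
`1/(2π)³` times the integral equals `1/24`. -/
theorem stmt_8 :
    IntegrableOn weightIntegrand ((Set.univ : Set (ℝ × ℝ)) ×ˢ Set.Ioo (0 : ℝ) 1) ∧
    (∫ p in (Set.univ : Set (ℝ × ℝ)) ×ˢ Set.Ioo (0 : ℝ) 1, weightIntegrand p)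
      = Real.pi ^ 3 / 3 ∧
    (1 / (2 * Real.pi) ^ 3) *
      (∫ p in (Set.univ : Set (ℝ × ℝ)) ×ˢ Set.Ioo (0 : ℝ) 1, weightIntegrand p)
      = 1 / 24 := by
  have hval : (∫ p in (Set.univ : Set (ℝ × ℝ)) ×ˢ Set.Ioo (0 : ℝ) 1, weightIntegrand p)
      = Real.pi ^ 3 / 3 := by
    rw [integral_eq_lintegral_of_nonneg_ae (Filter.Eventually.of_forall w_nonneg)
      w_measurable.aestronglyMeasurable, total, ENNReal.toReal_ofReal (by positivity)]
  refine ⟨⟨w_measurable.aestronglyMeasurable, ?_⟩, hval, ?_⟩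
  · rw [hasFiniteIntegral_iff_ofReal (Filter.Eventually.of_forall w_nonneg), total]
    exact ENNReal.ofReal_lt_top
  · rw [hval]
    have := Real.pi_pos
    field_simp
    norm_num
end

section
/- The function (x, y) ↦ y / ((x² + y²)·((x − 1)² + y²)) is Lebesgue integrable on ℝ², and ∫_{ℝ²} y / ((x² + y²)·((x − 1)² + y²)) dx dy = 0. -/
open MeasureTheory

noncomputable def gAux (x : ℝ) : ℝ := 1 / (√|x| * √(1 + x ^ 2))

lemma gAux_meas : Measurable gAux := by unfold gAux; fun_prop

lemma gAux_nonneg (x : ℝ) : 0 ≤ gAux x := by unfold gAux; positivity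

lemma gAux_neg (x : ℝ) : gAux (-x) = gAux x := by simp [gAux]

lemma gAux_Ioi : IntegrableOn gAux (Set.Ioi 0) := by
  rw [← Set.Ioc_union_Ioi_eq_Ioi (zero_le_one (α := ℝ))]
  refine IntegrableOn.union ?_ ?_
  · have h := (intervalIntegral.intervalIntegrable_rpow' (a := 0) (b := 1) (r := -(1 / 2))
      (by norm_num))
    rw [intervalIntegrable_iff_integrableOn_Ioc_of_le zero_le_one] at h
    refine Integrable.mono' h gAux_meas.aestronglyMeasurable ?_
    refine (ae_restrict_iff' measurableSet_Ioc).2 (Filter.Eventually.of_forall ?_)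
    intro x hx
    rw [Real.norm_of_nonneg (gAux_nonneg x), Real.rpow_neg hx.1.le, ← Real.sqrt_eq_rpow, gAux,
      abs_of_pos hx.1, ← one_div]
    have h1 : 0 < √x := Real.sqrt_pos.2 hx.1
    have h2 : 1 ≤ √(1 + x ^ 2) := Real.one_le_sqrt.2 (by nlinarith [sq_nonneg x])
    apply one_div_le_one_div_of_le h1
    nlinarith
  · have h := integrableOn_Ioi_rpow_of_lt (a := -(3 / 2)) (by norm_num) (zero_lt_one (α := ℝ))
    refine Integrable.mono' h gAux_meas.aestronglyMeasurable ?_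
    refine (ae_restrict_iff' measurableSet_Ioi).2 (Filter.Eventually.of_forall ?_)
    intro x hx
    have hx0 : (0 : ℝ) < x := lt_trans zero_lt_one hx
    have e : x ^ (-(3 / 2) : ℝ) = 1 / (√x * x) := by
      rw [Real.rpow_neg hx0.le, Real.sqrt_eq_rpow, one_div (_ * _), ← Real.rpow_add_one hx0.ne']
      norm_num
    rw [Real.norm_of_nonneg (gAux_nonneg x), e, gAux, abs_of_pos hx0]
    have h1 : 0 < √x := Real.sqrt_pos.2 hx0
    have h2 : x ≤ √(1 + x ^ 2) := Real.le_sqrt_of_sq_le (by linarith)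
    apply one_div_le_one_div_of_le (by positivity)
    gcongr

lemma gAux_int : Integrable gAux := by
  have h2 : IntegrableOn gAux (Set.Iio 0) := by
    have := gAux_Ioi
    rw [← (Measure.measurePreserving_neg (volume : Measure ℝ)).integrableOn_comp_preimage
      (MeasurableEquiv.neg ℝ).measurableEmbedding] at this
    have e : gAux ∘ Neg.neg = gAux := funext gAux_neg
    rw [e] at this
    simpa using this
  rw [← integrableOn_univ, ← Set.Iic_union_Ioi (a := (0 : ℝ))]
  exact ((integrableOn_Iic_iff_integrableOn_Iio).2 h2).union gAux_Ioi

lemma key (x y S : ℝ) (hx : x ≠ 0) (hS : (1 + x ^ 2 + y ^ 2) / 4 ≤ S) :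
    |y| / ((x ^ 2 + y ^ 2) * S) ≤ 4 * (gAux x * gAux y) := by
  rcases eq_or_ne y 0 with rfl | hy
  · simpa using mul_nonneg (gAux_nonneg x) (gAux_nonneg 0)
  have hs : 0 < √|x| := Real.sqrt_pos.2 (abs_pos.2 hx)
  have ht : 0 < √|y| := Real.sqrt_pos.2 (abs_pos.2 hy)
  have hs2 : √|x| ^ 2 = |x| := Real.sq_sqrt (abs_nonneg x)
  have ht2 : √|y| ^ 2 = |y| := Real.sq_sqrt (abs_nonneg y)
  have hp : 0 < √(1 + x ^ 2) := Real.sqrt_pos.2 (by positivity)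
  have hq : 0 < √(1 + y ^ 2) := Real.sqrt_pos.2 (by positivity)
  have hp2 : √(1 + x ^ 2) ^ 2 = 1 + x ^ 2 := Real.sq_sqrt (by positivity)
  have hq2 : √(1 + y ^ 2) ^ 2 = 1 + y ^ 2 := Real.sq_sqrt (by positivity)
  have hx2 : x ^ 2 = |x| ^ 2 := (sq_abs x).symm
  have hy2 : y ^ 2 = |y| ^ 2 := (sq_abs y).symm
  unfold gAux
  generalize √(1 + x ^ 2) = p at *
  generalize √(1 + y ^ 2) = q at *
  generalize √|x| = s at *
  generalize √|y| = t at *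
  have hS0 : 0 < S := lt_of_lt_of_le (by positivity) hS
  have h1 : |y| * (s * t) ≤ x ^ 2 + y ^ 2 := by
    rw [hx2, hy2, ← hs2, ← ht2]
    have a : s * t ≤ (s ^ 2 + t ^ 2) / 2 := by nlinarith [sq_nonneg (s - t)]
    have b : t ^ 2 * (s * t) ≤ t ^ 2 * ((s ^ 2 + t ^ 2) / 2) := by gcongr
    nlinarith [sq_nonneg (s ^ 2 - t ^ 2), sq_nonneg (s ^ 2), sq_nonneg (t ^ 2)]
  have h2 : p * q ≤ 4 * S := by nlinarith [sq_nonneg (p - q)]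
  have e : 4 * (1 / (s * p) * (1 / (t * q))) = 4 / ((s * t) * (p * q)) := by
    field_simp
  rw [e, div_le_div_iff₀ (by positivity) (by positivity)]
  calc |y| * (s * t * (p * q)) = (|y| * (s * t)) * (p * q) := by ring
    _ ≤ (x ^ 2 + y ^ 2) * (4 * S) := by gcongr
    _ = _ := by ring

lemma bnd (x y : ℝ) (hx : x ≠ 0) (hx1 : x - 1 ≠ 0) :
    ‖y / ((x ^ 2 + y ^ 2) * ((x - 1) ^ 2 + y ^ 2))‖ ≤
      4 * (gAux x * gAux y) + 4 * (gAux (x - 1) * gAux y) := by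
  have hA : 0 < x ^ 2 + y ^ 2 := by positivity
  have hB : 0 < (x - 1) ^ 2 + y ^ 2 := by positivity
  have k1 := key x y ((x ^ 2 + y ^ 2) + ((x - 1) ^ 2 + y ^ 2)) hx
    (by nlinarith [sq_nonneg (7 * x - 4), sq_nonneg y])
  have k2 := key (x - 1) y ((x ^ 2 + y ^ 2) + ((x - 1) ^ 2 + y ^ 2)) hx1
    (by nlinarith [sq_nonneg (7 * (x - 1) + 4), sq_nonneg y])
  refine le_trans (le_of_eq ?_) (add_le_add k1 k2)
  rw [Real.norm_eq_abs, abs_div, abs_of_pos (mul_pos hA hB)]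
  generalize x ^ 2 + y ^ 2 = A at *
  generalize (x - 1) ^ 2 + y ^ 2 = B at *
  field_simp
  ring

lemma int_main : Integrable (fun p : ℝ × ℝ =>
      p.2 / ((p.1 ^ 2 + p.2 ^ 2) * ((p.1 - 1) ^ 2 + p.2 ^ 2))) := by
  have i1 : Integrable (fun p : ℝ × ℝ => gAux p.1 * gAux p.2) := gAux_int.mul_prod gAux_int
  have i2 : Integrable (fun p : ℝ × ℝ => gAux (p.1 - 1) * gAux p.2) :=
    (gAux_int.comp_sub_right 1).mul_prod gAux_int
  refine Integrable.mono' ((i1.const_mul 4).add (i2.const_mul 4))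
    (Measurable.aestronglyMeasurable (by fun_prop)) ?_
  have ae (c : ℝ) : ∀ᵐ p : ℝ × ℝ, p.1 ≠ c :=
    Measure.quasiMeasurePreserving_fst.ae (Measure.ae_ne volume c)
  filter_upwards [ae 0, ae 1] with p h0 h1
  exact bnd p.1 p.2 h0 (sub_ne_zero.2 h1)

/-- the function `(x, y) ↦ y/((x² + y²)·((x − 1)² + y²))` is Lebesgue
integrable on `ℝ²`, and its integral over `ℝ²` equals `0`. -/
theorem stmt_9 :
    Integrable (fun p : ℝ × ℝ =>
      p.2 / ((p.1 ^ 2 + p.2 ^ 2) * ((p.1 - 1) ^ 2 + p.2 ^ 2))) ∧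
    (∫ p : ℝ × ℝ, p.2 / ((p.1 ^ 2 + p.2 ^ 2) * ((p.1 - 1) ^ 2 + p.2 ^ 2))) = 0 := by
  refine ⟨int_main, ?_⟩
  have h := integral_prod _ int_main
  refine h.trans (integral_eq_zero_of_ae (Filter.Eventually.of_forall fun x => ?_))
  have h2 := integral_neg_eq_self
    (fun y : ℝ => y / ((x ^ 2 + y ^ 2) * ((x - 1) ^ 2 + y ^ 2))) volume
  simp only [even_two, Even.neg_pow, neg_div, integral_neg] at h2
  simp only [Pi.zero_apply]
  linarith
end
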